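/- Concavity of the risky Bellman operator: consider a balanced MDP and let α ∈ (0,1). If Q₁ ≤ Q^* and Q̃₁ ≤ Q^* pointwise on X×A (where Q^*(x,a) = V^*(x)), then for any 0 ≤ λ ≤ 1, T^risky_α(λQ₁ + (1−λ)Q̃₁) ≥ λ T^risky_α Q₁ + (1−λ) T^risky_α Q̃₁ pointwise. -/

import Mathlib

open MeasureTheory ProbabilityTheory Finset Set

noncomputable section

/-- Quantile (generalized inverse distribution) function of a measure on `ℝ`. -/
def quantileFn (ν : Measure ℝ) (τ : ℝ) : ℝ :=
  sInf {z : ℝ | τ ≤ cdf ν z}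

/-- Left average value-at-risk at level `α`. -/
def avarLeft (α : ℝ) (ν : Measure ℝ) : ℝ :=
  (1 / α) * ∫ τ in (0:ℝ)..α, quantileFn ν τ

/-- Right average value-at-risk at level `1 - α`. -/
def avarRight (α : ℝ) (ν : Measure ℝ) : ℝ :=
  (1 / (1 - α)) * ∫ τ in α..(1:ℝ), quantileFn ν τ

/-- A measure on `ℝ` with bounded support. -/
def HasBoundedSupport (ν : Measure ℝ) : Prop :=
  ∃ a b : ℝ, ν (Set.Icc a b)ᶜ = 0

/-- Finite Markov decision process with fixed state and action spaces. -/
structure MDP (X A : Type) [Fintype X] [Fintype A] where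
  P : X → A → X → ℝ
  r : X → A → X → ℝ
  γ : ℝ
  P_nonneg : ∀ x a x', 0 ≤ P x a x'
  P_sum_one : ∀ x a, ∑ x', P x a x' = 1
  γ_nonneg : 0 ≤ γ
  γ_lt_one : γ < 1

variable {X A : Type} [Fintype X] [Fintype A]

/-- A stationary Markovian policy. -/
def IsPolicy (π : X → A → ℝ) : Prop :=
  (∀ x a, 0 ≤ π x a) ∧ ∀ x, ∑ a, π x a = 1

/-- The discrete measure `(T^π D_{α,Q})^{(x,a)}`. -/
def diatomicMeasure (M : MDP X A) (α : ℝ) (π : X → A → ℝ)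
    (Q : X → A → ℝ × ℝ) (x : X) (a : A) : Measure ℝ :=
  ∑ x' : X, ∑ a' : A, ENNReal.ofReal (M.P x a x' * π x' a') •
    (ENNReal.ofReal α • Measure.dirac (M.r x a x' + M.γ * (Q x' a').1)
      + ENNReal.ofReal (1 - α) • Measure.dirac (M.r x a x' + M.γ * (Q x' a').2))

/-- The diatomic Bellman operator `T^π_α`. -/
def diatomicT (M : MDP X A) (α : ℝ) (π : X → A → ℝ)
    (Q : X → A → ℝ × ℝ) : X → A → ℝ × ℝ :=
  fun x a => (avarLeft α (diatomicMeasure M α π Q x a),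
              avarRight α (diatomicMeasure M α π Q x a))

variable [Nonempty A]

/-- The second component `Q₂` determined by `Q₁` in a balanced MDP. -/
def Q2of (α : ℝ) (Vstar : X → ℝ) (Q1 : X → A → ℝ) : X → A → ℝ :=
  fun x a => (Vstar x - α * Q1 x a) / (1 - α)

/-- The MDP is balanced: `Q^*(x,a) = V^*(x)` for all `(x,a)`, i.e. `V^*` solves the
Bellman optimality equation with all actions optimal. -/
def IsBalanced (M : MDP X A) (Vstar : X → ℝ) : Prop :=
  ∀ x a, Vstar x = ∑ x', M.P x a x' * (M.r x a x' + M.γ * Vstar x')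

/-- The discrete measure appearing in the safe Bellman operator. -/
def safeMeasure (M : MDP X A) (α : ℝ) (Vstar : X → ℝ) (Q1 : X → A → ℝ)
    (x : X) (a : A) : Measure ℝ :=
  ∑ x' : X, ENNReal.ofReal (M.P x a x') •
    (ENNReal.ofReal α • Measure.dirac (M.r x a x' + M.γ * ⨆ a', Q1 x' a')
      + ENNReal.ofReal (1 - α) •
          Measure.dirac (M.r x a x' + M.γ * ⨅ a', Q2of α Vstar Q1 x' a'))

/-- The discrete measure appearing in the risky Bellman operator. -/
def riskyMeasure (M : MDP X A) (α : ℝ) (Vstar : X → ℝ) (Q1 : X → A → ℝ)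
    (x : X) (a : A) : Measure ℝ :=
  ∑ x' : X, ENNReal.ofReal (M.P x a x') •
    (ENNReal.ofReal α • Measure.dirac (M.r x a x' + M.γ * ⨅ a', Q1 x' a')
      + ENNReal.ofReal (1 - α) •
          Measure.dirac (M.r x a x' + M.γ * ⨆ a', Q2of α Vstar Q1 x' a'))

/-- The safe Bellman operator `T^safe_α`. -/
def Tsafe (M : MDP X A) (α : ℝ) (Vstar : X → ℝ) (Q1 : X → A → ℝ) : X → A → ℝ :=
  fun x a => avarLeft α (safeMeasure M α Vstar Q1 x a)

/-- The risky Bellman operator `T^risky_α`. -/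
def Trisky (M : MDP X A) (α : ℝ) (Vstar : X → ℝ) (Q1 : X → A → ℝ) : X → A → ℝ :=
  fun x a => avarLeft α (riskyMeasure M α Vstar Q1 x a)

theorem quantileFn_le_iff (ν : Measure ℝ) {τ : ℝ} (hτ : τ ∈ Set.Ioo (0:ℝ) 1) (z : ℝ) :
    quantileFn ν τ ≤ z ↔ τ ≤ cdf ν z := by
  have hne : {z : ℝ | τ ≤ cdf ν z}.Nonempty :=
    ((tendsto_cdf_atTop ν).eventually_const_le hτ.2).exists
  obtain ⟨b, hb⟩ := ((tendsto_cdf_atBot ν).eventually_lt_const hτ.1).exists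
  have hbdd : BddBelow {z : ℝ | τ ≤ cdf ν z} := by
    refine ⟨b, fun y hy => ?_⟩
    by_contra! h
    exact absurd (hy.trans (monotone_cdf ν h.le)) (not_le.2 hb)
  refine ⟨fun h => ?_, fun h => csInf_le hbdd h⟩
  have hright : Filter.Tendsto (cdf ν) (nhdsWithin z (Set.Ioi z)) (nhds (cdf ν z)) :=
    ((cdf ν).right_continuous z).mono_left (nhdsWithin_mono z Set.Ioi_subset_Ici_self)
  refine ge_of_tendsto hright ?_
  filter_upwards [self_mem_nhdsWithin] with y hy
  obtain ⟨w, hw, hwy⟩ := exists_lt_of_csInf_lt hne (lt_of_le_of_lt h hy)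
  exact le_trans hw (monotone_cdf ν hwy.le)

theorem monotoneOn_quantileFn (ν : Measure ℝ) :
    MonotoneOn (quantileFn ν) (Set.Ioo (0:ℝ) 1) := fun _ hs _ ht hst =>
  (quantileFn_le_iff ν hs _).2 (hst.trans ((quantileFn_le_iff ν ht _).1 le_rfl))

theorem aemeasurable_quantileFn (ν : Measure ℝ) :
    AEMeasurable (quantileFn ν) (volume.restrict (Set.Ioo (0:ℝ) 1)) :=
  aemeasurable_restrict_of_monotoneOn measurableSet_Ioo (monotoneOn_quantileFn ν)

/-- The quantile function pushes the uniform distribution forward to the given measure. -/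
theorem map_quantileFn (ν : Measure ℝ) [IsProbabilityMeasure ν] :
    (volume.restrict (Set.Ioo (0:ℝ) 1)).map (quantileFn ν) = ν := by
  refine Measure.ext_of_Iic _ _ fun z => ?_
  rw [Measure.map_apply_of_aemeasurable (aemeasurable_quantileFn ν) measurableSet_Iic,
    Measure.restrict_apply' measurableSet_Ioo, ← ofReal_cdf]
  have hset : quantileFn ν ⁻¹' Set.Iic z ∩ Set.Ioo (0:ℝ) 1
      = Set.Iic (cdf ν z) ∩ Set.Ioo (0:ℝ) 1 := by
    ext τ
    exact and_congr_left fun hτ => quantileFn_le_iff ν hτ z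
  rw [hset]
  apply le_antisymm
  · calc volume (Set.Iic (cdf ν z) ∩ Set.Ioo (0:ℝ) 1)
        ≤ volume (Set.Ioc 0 (cdf ν z)) := measure_mono fun τ hτ => ⟨hτ.2.1, hτ.1⟩
      _ = _ := by simp
  · calc ENNReal.ofReal (cdf ν z) = volume (Set.Ioo 0 (cdf ν z)) := by simp
      _ ≤ volume (Set.Iic (cdf ν z) ∩ Set.Ioo (0:ℝ) 1) := measure_mono fun τ hτ =>
          ⟨hτ.2.le, hτ.1, hτ.2.trans_le (cdf_le_one ν z)⟩

theorem integral_comp_quantileFn (ν : Measure ℝ) [IsProbabilityMeasure ν] {f : ℝ → ℝ}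
    (hf : Continuous f) :
    ∫ τ in Set.Ioo (0:ℝ) 1, f (quantileFn ν τ) = ∫ z, f z ∂ν := by
  conv_rhs => rw [← map_quantileFn ν]
  exact (integral_map (aemeasurable_quantileFn ν) hf.aestronglyMeasurable).symm

theorem integrableOn_quantileFn (ν : Measure ℝ) [IsProbabilityMeasure ν]
    (hν : Integrable (fun z => z) ν) :
    IntegrableOn (quantileFn ν) (Set.Ioo (0:ℝ) 1) := by
  rw [← map_quantileFn ν] at hν
  exact hν.comp_aemeasurable (aemeasurable_quantileFn ν)

theorem mul_avarLeft {α : ℝ} (hα : α ∈ Set.Ioo (0:ℝ) 1) (ν : Measure ℝ) :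
    α * avarLeft α ν = ∫ τ in Set.Ioo (0:ℝ) α, quantileFn ν τ := by
  rw [avarLeft, intervalIntegral.integral_of_le hα.1.le, integral_Ioc_eq_integral_Ioo,
    ← mul_assoc, mul_one_div_cancel hα.1.ne', one_mul]

theorem setIntegral_const_sub_quantileFn {α : ℝ} (hα : α ∈ Set.Ioo (0:ℝ) 1) (ν : Measure ℝ)
    [IsProbabilityMeasure ν] (hν : Integrable (fun z => z) ν) (c : ℝ) :
    ∫ τ in Set.Ioo (0:ℝ) α, (c - quantileFn ν τ) = α * c - α * avarLeft α ν := by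
  rw [integral_sub (integrable_const c) ((integrableOn_quantileFn ν hν).mono_set
    (Set.Ioo_subset_Ioo_right hα.2.le)), mul_avarLeft hα]
  simp [hα.1.le]

/-- The Rockafellar–Uryasev lower bound for the left average value-at-risk. -/
theorem sub_integral_max_le_mul_avarLeft {α : ℝ} (hα : α ∈ Set.Ioo (0:ℝ) 1) (ν : Measure ℝ)
    [IsProbabilityMeasure ν] (hν : Integrable (fun z => z) ν) (c : ℝ) :
    α * c - ∫ z, max (c - z) 0 ∂ν ≤ α * avarLeft α ν := by
  have hsub : Set.Ioo (0:ℝ) α ⊆ Set.Ioo 0 1 := Set.Ioo_subset_Ioo_right hα.2.le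
  have hintegrable : IntegrableOn (fun τ => c - quantileFn ν τ) (Set.Ioo (0:ℝ) 1) :=
    (integrable_const c).sub (integrableOn_quantileFn ν hν)
  have h₁ : ∫ τ in Set.Ioo (0:ℝ) α, (c - quantileFn ν τ)
      ≤ ∫ τ in Set.Ioo (0:ℝ) α, max (c - quantileFn ν τ) 0 :=
    integral_mono (hintegrable.mono_set hsub) (hintegrable.pos_part.mono_measure
      (Measure.restrict_mono_set _ hsub)) fun τ => le_max_left _ _
  have h₂ : ∫ τ in Set.Ioo (0:ℝ) α, max (c - quantileFn ν τ) 0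
      ≤ ∫ τ in Set.Ioo (0:ℝ) 1, max (c - quantileFn ν τ) 0 :=
    setIntegral_mono_set hintegrable.pos_part (Filter.Eventually.of_forall fun τ => le_max_right _ _)
      hsub.eventuallyLE
  rw [integral_comp_quantileFn ν (f := fun z => max (c - z) 0) (by fun_prop)] at h₂
  rw [setIntegral_const_sub_quantileFn hα ν hν] at h₁
  linarith

/-- The Rockafellar–Uryasev bound is attained at the `α`-quantile. -/
theorem mul_avarLeft_eq_quantileFn {α : ℝ} (hα : α ∈ Set.Ioo (0:ℝ) 1) (ν : Measure ℝ)
    [IsProbabilityMeasure ν] (hν : Integrable (fun z => z) ν) :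
    α * avarLeft α ν = α * quantileFn ν α - ∫ z, max (quantileFn ν α - z) 0 ∂ν := by
  have hsub : Set.Ioo (0:ℝ) α ⊆ Set.Ioo 0 1 := Set.Ioo_subset_Ioo_right hα.2.le
  have h₁ : ∫ τ in Set.Ioo (0:ℝ) 1, max (quantileFn ν α - quantileFn ν τ) 0
      = ∫ τ in Set.Ioo (0:ℝ) α, max (quantileFn ν α - quantileFn ν τ) 0 := by
    refine setIntegral_eq_of_subset_of_forall_sdiff_eq_zero measurableSet_Ioo hsub
      fun τ hτ => max_eq_right (sub_nonpos.2 ?_)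
    refine monotoneOn_quantileFn ν hα hτ.1 ?_
    by_contra! h
    exact hτ.2 ⟨hτ.1.1, h⟩
  have h₂ : ∫ τ in Set.Ioo (0:ℝ) α, max (quantileFn ν α - quantileFn ν τ) 0
      = ∫ τ in Set.Ioo (0:ℝ) α, (quantileFn ν α - quantileFn ν τ) :=
    setIntegral_congr_fun measurableSet_Ioo fun τ hτ =>
      max_eq_left (sub_nonneg.2 (monotoneOn_quantileFn ν (hsub hτ) hα hτ.2.le))
  rw [integral_comp_quantileFn ν (f := fun z => max (quantileFn ν α - z) 0) (by fun_prop)] at h₁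
  rw [h₁, h₂, setIntegral_const_sub_quantileFn hα ν hν]
  ring

theorem iSup_Q2of {S B : Type} [Fintype B] [Nonempty B] {α : ℝ} (hα : α ∈ Set.Ioo (0:ℝ) 1)
    (Vstar : S → ℝ) (Q : S → B → ℝ) (x : S) :
    ⨆ a, Q2of α Vstar Q x a = (Vstar x - α * ⨅ a, Q x a) / (1 - α) := by
  have h₁ : 0 < 1 - α := sub_pos.2 hα.2
  apply le_antisymm
  · refine ciSup_le fun a => ?_
    have := ciInf_le (Set.finite_range (Q x)).bddBelow a
    have := mul_le_mul_of_nonneg_left this hα.1.le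
    exact div_le_div_of_nonneg_right (by linarith) h₁.le
  · obtain ⟨a, ha⟩ := exists_eq_ciInf_of_finite (f := Q x)
    rw [← ha]
    exact le_ciSup (f := Q2of α Vstar Q x) (Set.finite_range _).bddAbove a

theorem isProbabilityMeasure_riskyMeasure {S B : Type} [Fintype S] [Fintype B] (M : MDP S B)
    {α : ℝ} (hα : α ∈ Set.Ioo (0:ℝ) 1) (Vstar : S → ℝ) (Q : S → B → ℝ) (x : S) (a : B) :
    IsProbabilityMeasure (riskyMeasure M α Vstar Q x a) := by
  constructor
  have h : ENNReal.ofReal α + ENNReal.ofReal (1 - α) = 1 := by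
    rw [← ENNReal.ofReal_add hα.1.le (sub_nonneg.2 hα.2.le)]
    simp
  simp [riskyMeasure, ← mul_add, h,
    ← ENNReal.ofReal_sum_of_nonneg (fun x' _ => M.P_nonneg x a x'), M.P_sum_one]

theorem integrable_riskyMeasure {S B : Type} [Fintype S] [Fintype B] (M : MDP S B) (α : ℝ)
    (Vstar : S → ℝ) (Q : S → B → ℝ) (x : S) (a : B) (f : ℝ → ℝ) :
    Integrable f (riskyMeasure M α Vstar Q x a) := by
  refine integrable_finsetSum_measure.2 fun x' _ => Integrable.smul_measure ?_ ENNReal.ofReal_ne_top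
  exact ((integrable_dirac (by simp)).smul_measure ENNReal.ofReal_ne_top).add_measure
    ((integrable_dirac (by simp)).smul_measure ENNReal.ofReal_ne_top)

theorem integral_riskyMeasure (M : MDP X A) {α : ℝ} (hα : α ∈ Set.Ioo (0:ℝ) 1)
    (Vstar : X → ℝ) (Q : X → A → ℝ) (x : X) (a : A) (f : ℝ → ℝ) :
    ∫ z, f z ∂(riskyMeasure M α Vstar Q x a) =
      ∑ x', M.P x a x' * (α * f (M.r x a x' + M.γ * ⨅ a', Q x' a') +
        (1 - α) * f (M.r x a x' + M.γ * ((Vstar x' - α * ⨅ a', Q x' a') / (1 - α)))) := by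
  have hd : ∀ (w y : ℝ), Integrable f (ENNReal.ofReal w • Measure.dirac y) := fun w y =>
    (integrable_dirac (by simp)).smul_measure ENNReal.ofReal_ne_top
  rw [riskyMeasure, integral_finsetSum_measure fun x' _ =>
    ((hd _ _).add_measure (hd _ _)).smul_measure ENNReal.ofReal_ne_top]
  refine Finset.sum_congr rfl fun x' _ => ?_
  rw [integral_smul_measure, integral_add_measure (hd _ _) (hd _ _), integral_smul_measure,
    integral_smul_measure, integral_dirac, integral_dirac, iSup_Q2of hα,
    ENNReal.toReal_ofReal (M.P_nonneg x a x'), ENNReal.toReal_ofReal hα.1.le,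
    ENNReal.toReal_ofReal (sub_nonneg.2 hα.2.le)]
  simp only [smul_eq_mul]

/-- A mean-preserving spread of a two-point distribution increases the expected positive part. -/
theorem add_mul_max_le_of_spread {p q u v u' v' : ℝ} (hp : 0 ≤ p) (hq : 0 ≤ q) (hvu : v ≤ u)
    (hu : u ≤ u') (hmean : p * u + q * v = p * u' + q * v') :
    p * max u 0 + q * max v 0 ≤ p * max u' 0 + q * max v' 0 := by
  have hu' := mul_le_mul_of_nonneg_left (le_max_left u' 0) hp
  have hv' := mul_le_mul_of_nonneg_left (le_max_left v' 0) hq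
  have hu₀ := mul_nonneg hp (le_max_right u' 0)
  have hv₀ := mul_nonneg hq (le_max_right v' 0)
  have hpu := mul_le_mul_of_nonneg_left hu hp
  rcases le_total u 0 with h | h
  · rw [max_eq_right h, max_eq_right (hvu.trans h)]
    linarith
  · rcases le_total v 0 with h' | h'
    · rw [max_eq_left h, max_eq_right h']
      linarith
    · rw [max_eq_left h, max_eq_left h']
      linarith

theorem max_convexComb_le {s t : ℝ} (hs : 0 ≤ s) (ht : 0 ≤ t) (u v : ℝ) :
    max (s * u + t * v) 0 ≤ s * max u 0 + t * max v 0 :=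
  max_le (add_le_add (mul_le_mul_of_nonneg_left (le_max_left _ _) hs)
    (mul_le_mul_of_nonneg_left (le_max_left _ _) ht)) (by positivity)

/-- The expected shortfall of a two-point distribution with mean `r + γ V` and lower atom
`r + γ m` is jointly convex in the threshold and `m`, and antitone in `m ≤ V`. -/
theorem twoPoint_shortfall_le {α γ r V m m₁ m₂ c₁ c₂ s t : ℝ} (hα : α ∈ Set.Ioo (0:ℝ) 1)
    (hγ : 0 ≤ γ) (hs : 0 ≤ s) (ht : 0 ≤ t) (hst : s + t = 1) (hmV : m ≤ V)
    (hm : s * m₁ + t * m₂ ≤ m) :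
    α * max (s * c₁ + t * c₂ - (r + γ * m)) 0
        + (1 - α) * max (s * c₁ + t * c₂ - (r + γ * ((V - α * m) / (1 - α)))) 0 ≤
      s * (α * max (c₁ - (r + γ * m₁)) 0
          + (1 - α) * max (c₁ - (r + γ * ((V - α * m₁) / (1 - α)))) 0)
        + t * (α * max (c₂ - (r + γ * m₂)) 0
          + (1 - α) * max (c₂ - (r + γ * ((V - α * m₂) / (1 - α)))) 0) := by
  have hα' : 0 < 1 - α := sub_pos.2 hα.2
  obtain rfl : t = 1 - s := by linarith
  have hmw : m ≤ (V - α * m) / (1 - α) := by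
    rw [le_div_iff₀ hα']
    linarith
  have hspread := add_mul_max_le_of_spread (p := α) (q := 1 - α)
    (u := s * c₁ + (1 - s) * c₂ - (r + γ * m))
    (v := s * c₁ + (1 - s) * c₂ - (r + γ * ((V - α * m) / (1 - α))))
    (u' := s * (c₁ - (r + γ * m₁)) + (1 - s) * (c₂ - (r + γ * m₂)))
    (v' := s * (c₁ - (r + γ * ((V - α * m₁) / (1 - α))))
      + (1 - s) * (c₂ - (r + γ * ((V - α * m₂) / (1 - α)))))
    hα.1.le hα'.le
    (by linarith [mul_le_mul_of_nonneg_left hmw hγ])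
    (by linarith [mul_le_mul_of_nonneg_left hm hγ])
    (by field_simp; ring)
  have h₁ := mul_le_mul_of_nonneg_left
    (max_convexComb_le hs ht (c₁ - (r + γ * m₁)) (c₂ - (r + γ * m₂))) hα.1.le
  have h₂ := mul_le_mul_of_nonneg_left
    (max_convexComb_le hs ht (c₁ - (r + γ * ((V - α * m₁) / (1 - α))))
      (c₂ - (r + γ * ((V - α * m₂) / (1 - α))))) hα'.le
  linarith

theorem stmt14 (M : MDP X A) (α : ℝ) (hα : α ∈ Set.Ioo (0:ℝ) 1)
    (Vstar : X → ℝ) (hbal : IsBalanced M Vstar)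
    (Q1 Qt1 : X → A → ℝ)
    (hQ : ∀ x a, Q1 x a ≤ Vstar x) (hQt : ∀ x a, Qt1 x a ≤ Vstar x)
    (lam : ℝ) (hlam : lam ∈ Set.Icc (0:ℝ) 1) :
    ∀ x a,
      lam * Trisky M α Vstar Q1 x a + (1 - lam) * Trisky M α Vstar Qt1 x a ≤
        Trisky M α Vstar (fun x a => lam * Q1 x a + (1 - lam) * Qt1 x a) x a := by
  intro x a
  set Q3 : X → A → ℝ := fun x a => lam * Q1 x a + (1 - lam) * Qt1 x a with hQ3
  have hlam' : 0 ≤ 1 - lam := sub_nonneg.2 hlam.2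
  have hprob := isProbabilityMeasure_riskyMeasure M hα Vstar
  have hintegrable := fun Q => integrable_riskyMeasure M α Vstar Q x a (fun z => z)
  have hinf : ∀ x', lam * (⨅ a', Q1 x' a') + (1 - lam) * (⨅ a', Qt1 x' a') ≤ ⨅ a', Q3 x' a' :=
    fun x' => le_ciInf fun a' => add_le_add
      (mul_le_mul_of_nonneg_left (ciInf_le (Set.finite_range _).bddBelow a') hlam.1)
      (mul_le_mul_of_nonneg_left (ciInf_le (Set.finite_range _).bddBelow a') hlam')
  have hV : ∀ x', ⨅ a', Q3 x' a' ≤ Vstar x' := fun x' =>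
    (ciInf_le (Set.finite_range (Q3 x')).bddBelow (Classical.arbitrary A)).trans <| by
      linarith [mul_le_mul_of_nonneg_left (hQ x' (Classical.arbitrary A)) hlam.1,
        mul_le_mul_of_nonneg_left (hQt x' (Classical.arbitrary A)) hlam']
  have := hprob Q1 x a
  have := hprob Qt1 x a
  have := hprob Q3 x a
  set c₁ := quantileFn (riskyMeasure M α Vstar Q1 x a) α
  set c₂ := quantileFn (riskyMeasure M α Vstar Qt1 x a) α
  have h₁ : α * avarLeft α (riskyMeasure M α Vstar Q1 x a) = _ :=
    mul_avarLeft_eq_quantileFn hα _ (hintegrable Q1)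
  have h₂ : α * avarLeft α (riskyMeasure M α Vstar Qt1 x a) = _ :=
    mul_avarLeft_eq_quantileFn hα _ (hintegrable Qt1)
  have h₃ := sub_integral_max_le_mul_avarLeft hα _ (hintegrable Q3) (lam * c₁ + (1 - lam) * c₂)
  have hkey : ∫ z, max (lam * c₁ + (1 - lam) * c₂ - z) 0 ∂(riskyMeasure M α Vstar Q3 x a) ≤
      lam * ∫ z, max (c₁ - z) 0 ∂(riskyMeasure M α Vstar Q1 x a)
        + (1 - lam) * ∫ z, max (c₂ - z) 0 ∂(riskyMeasure M α Vstar Qt1 x a) := by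
    rw [integral_riskyMeasure M hα, integral_riskyMeasure M hα, integral_riskyMeasure M hα,
      Finset.mul_sum, Finset.mul_sum, ← Finset.sum_add_distrib]
    refine Finset.sum_le_sum fun x' _ => ?_
    refine (mul_le_mul_of_nonneg_left (twoPoint_shortfall_le hα M.γ_nonneg hlam.1 hlam'
      (by ring) (hV x') (hinf x')) (M.P_nonneg x a x')).trans_eq ?_
    ring
  refine le_of_mul_le_mul_left ?_ hα.1
  calc α * (lam * Trisky M α Vstar Q1 x a + (1 - lam) * Trisky M α Vstar Qt1 x a)
      = lam * (α * avarLeft α (riskyMeasure M α Vstar Q1 x a))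
        + (1 - lam) * (α * avarLeft α (riskyMeasure M α Vstar Qt1 x a)) := by
        rw [Trisky, Trisky]
        ring
    _ ≤ α * avarLeft α (riskyMeasure M α Vstar Q3 x a) := by
        rw [h₁, h₂]
        linarith

end
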